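/- Let $G$ be a connected bipartite graph on $n$ vertices. Assume that the height one monomial prime ideals of $R_G$ containing $t$ are exactly the ideals $P_C$ for $C$ a minimal vertex cover of $G$, with support forms $f_C(x) = -\sum_{i\notin C} x_i + x_{n+1}$. Then $R_G$ is Gorenstein if and only if $G$ is unmixed, i.e., all minimal vertex covers of $G$ have the same cardinality. -/

import Mathlib

open MvPolynomial

set_option synthInstance.maxHeartbeats 1000000

noncomputable section

/-- The ambient polynomial ring `K[x_i : i ∈ V][t]`, with the variable `none` playing
the role of `t`. -/
abbrev Amb (K V : Type*) [CommSemiring K] := MvPolynomial (Option V) K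

variable (K : Type*) [Field K] {V : Type*} [DecidableEq V]

/-- The generator `t`. -/
def tGen : Amb K V := X none

/-- The generator `x_i t`. -/
def vGen (i : V) : Amb K V := X (some i) * X none

/-- The generator `x_i x_j t`. -/
def eGen (i j : V) : Amb K V := X (some i) * X (some j) * X none

variable (G : SimpleGraph V)

/-- The toric ring `R_G = K[t, {x_i t}, {x_i x_j t : {i,j} ∈ E(G)}]` of the graph `G`. -/
def RG : Subalgebra K (Amb K V) :=
  Algebra.adjoin K
    ({tGen K} ∪ Set.range (vGen K (V := V)) ∪ {p | ∃ i j, G.Adj i j ∧ p = eGen K i j})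

/-- The faces of the one-dimensional simplicial complex attached to `G`. -/
def IsFace (F : Finset V) : Prop :=
  F = ∅ ∨ (∃ i, F = {i}) ∨ ∃ i j, G.Adj i j ∧ F = {i, j}

/-- The monomial `x_F t`. -/
def faceMon (F : Finset V) : Amb K V := (∏ i ∈ F, X (some i)) * X none

/-- The ideal `P_0 = (t, x_1 t, …, x_n t)` of `R_G`. -/
def P0 : Ideal (RG K G) :=
  Ideal.span {u : RG K G | ((u : Amb K V) = tGen K) ∨ ∃ i, (u : Amb K V) = vGen K i}

/-- The principal ideal `(t)` of `R_G`. -/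
def tIdeal : Ideal (RG K G) := Ideal.span {u : RG K G | (u : Amb K V) = tGen K}

/-- The ideal `P_C` generated by the monomials `x_F t` for faces `F ⊆ C`. -/
def PC (C : Finset V) : Ideal (RG K G) :=
  Ideal.span {u : RG K G | ∃ F : Finset V, IsFace G F ∧ F ⊆ C ∧ (u : Amb K V) = faceMon K F}

/-- The ideal `Q_i` generated by the monomials `x_F t` for faces `F ∋ i`. -/
def Qi (i : V) : Ideal (RG K G) :=
  Ideal.span {u : RG K G | ∃ F : Finset V, IsFace G F ∧ i ∈ F ∧ (u : Amb K V) = faceMon K F}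

/-- A vertex cover of `G`. -/
def IsVertexCover (C : Finset V) : Prop := ∀ ⦃i j⦄, G.Adj i j → i ∈ C ∨ j ∈ C

/-- A minimal vertex cover of `G`. -/
def IsMinVertexCover (C : Finset V) : Prop :=
  IsVertexCover G C ∧ ∀ C' ⊆ C, IsVertexCover G C' → C' = C

/-- An induced odd cycle of `G`, given by an injective cyclic enumeration of its
vertices such that adjacency holds exactly between consecutive vertices. -/
def IsInducedOddCycle {V : Type*} (G : SimpleGraph V) (m : ℕ) (c : ZMod m → V) : Prop :=
  3 ≤ m ∧ Odd m ∧ Function.Injective c ∧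
    ∀ p q : ZMod m, G.Adj (c p) (c q) ↔ (q = p + 1 ∨ p = q + 1)

/-- The monomial `x^a t^b` of the ambient ring. -/
def monom [Fintype V] (a : V → ℕ) (b : ℕ) : Amb K V :=
  (∏ i, X (some i) ^ a i) * X none ^ b

/-- An element of `R_G` which is a monomial. -/
def IsMonomialElt [Fintype V] (u : RG K G) : Prop :=
  ∃ (a : V → ℕ) (b : ℕ), (u : Amb K V) = monom K a b

/-- A monomial ideal of `R_G`. -/
def IsMonomialIdeal [Fintype V] (I : Ideal (RG K G)) : Prop :=
  ∃ S : Set (RG K G), (∀ u ∈ S, IsMonomialElt K G u) ∧ I = Ideal.span S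

/-- A height one ideal of the domain `R_G`: a nonzero prime all of whose properly
contained primes are zero. -/
def HeightOne (I : Ideal (RG K G)) : Prop :=
  I.IsPrime ∧ I ≠ ⊥ ∧ ∀ J : Ideal (RG K G), J.IsPrime → J < I → J = ⊥

/-- The ideal contains the element `t`. -/
def ContainsT (I : Ideal (RG K G)) : Prop := ∃ u ∈ I, (u : Amb K V) = tGen K

/-- The canonical ideal of `R_G` (for `R_G` normal): the intersection of all height one
monomial prime ideals. -/
def canonicalIdeal [Fintype V] : Ideal (RG K G) :=
  sInf {P : Ideal (RG K G) | HeightOne K G P ∧ IsMonomialIdeal K G P}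

/-- `R_G` is Gorenstein: the canonical ideal (= canonical module) is isomorphic to
`R_G` as an `R_G`-module, equivalently it is a principal ideal, i.e. the canonical
class vanishes. -/
def IsGorensteinToric [Fintype V] : Prop :=
  (canonicalIdeal K G).IsPrincipal

section

set_option linter.unusedSectionVars false

/-- The exponent of the monomial `x_F t`. -/
def faceExp (F : Finset V) : Option V →₀ ℕ :=
  ∑ i ∈ F, Finsupp.single (some i) 1 + Finsupp.single none 1

lemma faceExp_none (F : Finset V) : faceExp F none = 1 := by
  simp [faceExp]

lemma faceExp_some (F : Finset V) (i : V) : faceExp F (some i) = if i ∈ F then 1 else 0 := by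
  simp [faceExp, Finsupp.single_apply]

lemma sum_faceExp (F I : Finset V) : ∑ i ∈ I, faceExp F (some i) = (I ∩ F).card := by
  simp [faceExp_some]

lemma faceMon_eq_monomial (F : Finset V) : faceMon K F = monomial (faceExp F) 1 := by
  unfold faceMon faceExp
  rw [← mul_one (1 : K), ← monomial_mul, monomial_sum_one]
  rfl

lemma monomial_eq_monom [Fintype V] (m : Option V →₀ ℕ) :
    (monomial m 1 : Amb K V) = monom K (fun i => m (some i)) (m none) := by
  rw [monic_monomial_eq, Finsupp.prod_fintype _ _ (by simp), Fintype.prod_option, mul_comm]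
  rfl

variable {G} in
lemma faceMon_mem_RG {F : Finset V} (hF : IsFace G F) : faceMon K F ∈ RG K G := by
  rcases hF with rfl | ⟨i, rfl⟩ | ⟨i, j, hij, rfl⟩
  · exact Algebra.subset_adjoin (Or.inl (Or.inl (by simp [faceMon, tGen])))
  · exact Algebra.subset_adjoin (Or.inl (Or.inr ⟨i, by simp [faceMon, vGen]⟩))
  · exact Algebra.subset_adjoin (Or.inr ⟨i, j, hij, by
      simp [faceMon, eGen, Finset.prod_pair hij.ne]⟩)

lemma X_none_mem_RG : (X none : Amb K V) ∈ RG K G :=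
  Algebra.subset_adjoin (Or.inl (Or.inl rfl))

lemma vGen_mem_RG (i : V) : vGen K i ∈ RG K G :=
  Algebra.subset_adjoin (Or.inl (Or.inr ⟨i, rfl⟩))

lemma RG_le_of_faceMon {S : Subalgebra K (Amb K V)}
    (h : ∀ F, IsFace G F → faceMon K F ∈ S) : RG K G ≤ S := by
  refine Algebra.adjoin_le ?_
  rintro _ ((rfl | ⟨i, rfl⟩) | ⟨i, j, hij, rfl⟩)
  · simpa [faceMon, tGen] using h ∅ (Or.inl rfl)
  · simpa [faceMon, vGen] using h {i} (Or.inr (Or.inl ⟨i, rfl⟩))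
  · simpa [faceMon, eGen, Finset.prod_pair hij.ne] using
      h {i, j} (Or.inr (Or.inr ⟨i, j, hij, rfl⟩))

lemma forall_support_mul {p q r : (Option V →₀ ℕ) → Prop} {f g : Amb K V}
    (hf : ∀ m ∈ f.support, p m) (hg : ∀ m ∈ g.support, q m)
    (h : ∀ m m', p m → q m' → r (m + m')) : ∀ m ∈ (f * g).support, r m := by
  classical
  intro m hm
  obtain ⟨a, ha, b, hb, rfl⟩ := Finset.mem_add.1 (support_mul f g hm)
  exact h a b (hf a ha) (hg b hb)

/-- The exponents cut out by the inequalities `∑_{i ∈ I} x_i ≤ x_{n+1}` for `I` independent. -/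
def InCone (m : Option V →₀ ℕ) : Prop :=
  ∀ I : Finset V, G.IsIndepSet I → ∑ i ∈ I, m (some i) ≤ m none

variable {G}

lemma card_inter_face_le_one {F I : Finset V} (hF : IsFace G F) (hI : G.IsIndepSet I) :
    (I ∩ F).card ≤ 1 := by
  rw [Finset.card_le_one]
  intro a ha b hb
  rw [Finset.mem_inter] at ha hb
  by_contra hab
  have hnot := hI (Finset.mem_coe.2 ha.1) (Finset.mem_coe.2 hb.1) hab
  rcases hF with rfl | ⟨i, rfl⟩ | ⟨i, j, hij, rfl⟩
  · simp at ha
  · simp at ha hb; exact hab (ha.2.trans hb.2.symm)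
  · have h1 := ha.2
    have h2 := hb.2
    simp only [Finset.mem_insert, Finset.mem_singleton] at h1 h2
    rcases h1 with rfl | rfl <;> rcases h2 with rfl | rfl
    exacts [hab rfl, hnot hij, hnot hij.symm, hab rfl]

lemma InCone.add {m m' : Option V →₀ ℕ} (h : InCone G m) (h' : InCone G m') :
    InCone G (m + m') := by
  intro I hI
  simpa [Finset.sum_add_distrib] using add_le_add (h I hI) (h' I hI)

lemma inCone_faceExp {F : Finset V} (hF : IsFace G F) : InCone G (faceExp F) := by
  intro I hI
  rw [sum_faceExp, faceExp_none]
  exact card_inter_face_le_one hF hI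

variable (G) in
/-- The polynomials whose exponents all satisfy the inequalities of the cone. -/
def coneSubalgebra : Subalgebra K (Amb K V) where
  carrier := {f | ∀ m ∈ f.support, InCone G m}
  mul_mem' hf hg := forall_support_mul K hf hg fun _ _ => InCone.add
  add_mem' {f g} hf hg m hm := by
    rcases Finset.mem_union.1 (support_add hm) with h | h
    exacts [hf m h, hg m h]
  algebraMap_mem' r m hm := by
    have : m = 0 := by simpa using support_monomial_subset hm
    subst this
    intro I _
    simp

lemma inCone_of_mem_RG {f : Amb K V} (hf : f ∈ RG K G) {m : Option V →₀ ℕ}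
    (hm : m ∈ f.support) : InCone G m := by
  refine (RG_le_of_faceMon K G (S := coneSubalgebra K G) fun F hF => ?_) hf m hm
  intro m hm
  rw [faceMon_eq_monomial] at hm
  have : m = faceExp F := by simpa using support_monomial_subset hm
  exact this ▸ inCone_faceExp hF

lemma exists_face_meeting_tight [Fintype V] (c : G.Coloring (Fin 2)) (a : V → ℕ) (b : ℕ)
    (h : ∀ I : Finset V, G.IsIndepSet I → ∑ i ∈ I, a i ≤ b) {i : V} (hi : 0 < a i) :
    ∃ F : Finset V, IsFace G F ∧ (∀ v ∈ F, 0 < a v) ∧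
      ∀ I : Finset V, G.IsIndepSet I → ∑ i ∈ I, a i = b → ∃ v ∈ F, v ∈ I := by
  classical
  set T : Finset (Finset V) :=
    Finset.univ.filter fun I => G.IsIndepSet I ∧ ∑ i ∈ I, a i = b ∧ i ∉ I with hT
  by_cases hne : T.Nonempty
  swap
  · refine ⟨{i}, Or.inr (Or.inl ⟨i, rfl⟩), by simpa using hi, fun I hI hIb => ⟨i, by simp, ?_⟩⟩
    by_contra hiI
    exact hne ⟨I, by simp [hT, hI, hIb, hiI]⟩
  set A : Finset V := Finset.univ.filter fun v => c v = c i
  set B : Finset V := Finset.univ.filter fun v => c v ≠ c i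
  obtain ⟨J, hJT, hJmin⟩ := T.exists_min_image (fun J => (J ∩ B).card) hne
  simp only [hT, Finset.mem_filter, Finset.mem_univ, true_and] at hJT hJmin
  obtain ⟨hJ, hJb, hiJ⟩ := hJT
  have same : ∀ {u v : V}, u ∈ A → v ∈ A → ¬ G.Adj u v := by
    intro u v hu hv huv
    simp only [A, Finset.mem_filter, Finset.mem_univ, true_and] at hu hv
    exact c.valid huv (hu.trans hv.symm)
  have same' : ∀ {u v : V}, u ∈ B → v ∈ B → ¬ G.Adj u v := by
    intro u v hu hv huv
    simp only [B, Finset.mem_filter, Finset.mem_univ, true_and] at hu hv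
    have := c.valid huv
    omega
  have hAB : ∀ v, v ∈ A ∨ v ∈ B := fun v => by simp [A, B, em]
  have hnAB : ∀ v, v ∈ A → v ∈ B → False := fun v => by simp [A, B]
  have hiA : i ∈ A := by simp [A]
  have hJB : ∀ K : Finset V, G.IsIndepSet K → ∑ v ∈ K, a v = b → i ∉ K → J ∩ B ⊆ K := by
    intro K hK hKb hiK
    set U : Finset V := (A ∩ (J ∪ K)) ∪ (B ∩ (J ∩ K)) with hU
    set L : Finset V := (A ∩ (J ∩ K)) ∪ (B ∩ (J ∪ K)) with hL
    have indep : ∀ {P Q : Finset V}, P ⊆ A → Q ⊆ B → (∀ u ∈ P, ∀ v ∈ Q, ¬ G.Adj u v) →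
        G.IsIndepSet ((P ∪ Q : Finset V) : Set V) := by
      intro P Q hP hQ hPQ u hu v hv _
      simp only [Finset.coe_union, Set.mem_union, Finset.mem_coe] at hu hv
      rcases hu with hu | hu <;> rcases hv with hv | hv
      exacts [same (hP hu) (hP hv), hPQ u hu v hv, fun e => hPQ v hv u hu e.symm,
        same' (hQ hu) (hQ hv)]
    have noedge : ∀ {S : Finset V}, G.IsIndepSet (S : Set V) → ∀ {u v}, u ∈ S → v ∈ S →
        ¬ G.Adj u v := fun {S} hS {u v} hu hv e => hS hu hv e.ne e
    have hUi : G.IsIndepSet (U : Set V) := by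
      refine indep Finset.inter_subset_left Finset.inter_subset_left fun u hu v hv => ?_
      simp only [Finset.mem_inter, Finset.mem_union] at hu hv
      rcases hu.2 with hu | hu
      exacts [noedge hJ hu hv.2.1, noedge hK hu hv.2.2]
    have hLi : G.IsIndepSet (L : Set V) := by
      refine indep Finset.inter_subset_left Finset.inter_subset_left fun u hu v hv => ?_
      simp only [Finset.mem_inter, Finset.mem_union] at hu hv
      rcases hv.2 with hv | hv
      exacts [noedge hJ hu.2.1 hv, noedge hK hu.2.2 hv]
    have hsum : ∑ v ∈ U, a v + ∑ v ∈ L, a v = ∑ v ∈ J, a v + ∑ v ∈ K, a v := by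
      have key : ∀ S : Finset V, ∑ v ∈ S, a v = ∑ v, if v ∈ S then a v else 0 := by
        intro S; simp
      rw [key U, key L, key J, key K, ← Finset.sum_add_distrib, ← Finset.sum_add_distrib]
      refine Finset.sum_congr rfl fun v _ => ?_
      simp only [hU, hL, Finset.mem_union, Finset.mem_inter]
      rcases hAB v with hA | hB
      · have hB : v ∉ B := hnAB v hA
        by_cases hvJ : v ∈ J <;> by_cases hvK : v ∈ K <;> simp [hA, hB, hvJ, hvK]
      · have hA : v ∉ A := fun hA => hnAB v hA hB
        by_cases hvJ : v ∈ J <;> by_cases hvK : v ∈ K <;> simp [hA, hB, hvJ, hvK]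
    have hUb : ∑ v ∈ U, a v = b := by
      have := h U hUi
      have := h L hLi
      omega
    have hiU : i ∉ U := by
      simp only [hU, Finset.mem_union, Finset.mem_inter]
      rintro (⟨_, h | h⟩ | ⟨_, h, _⟩)
      exacts [hiJ h, hiK h, hiJ h]
    have hsub : U ∩ B ⊆ J ∩ B := by
      intro v hv
      simp only [hU, Finset.mem_union, Finset.mem_inter] at hv ⊢
      rcases hv with ⟨hv | hv, hvB⟩
      exacts [(hnAB v hv.1 hvB).elim, ⟨hv.2.1, hvB⟩]
    have heq := Finset.eq_of_subset_of_card_le hsub (hJmin U ⟨hUi, hUb, hiU⟩)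
    intro v hv
    rw [← heq] at hv
    simp only [hU, Finset.mem_union, Finset.mem_inter] at hv
    rcases hv with ⟨hv | hv, hvB⟩
    exacts [(hnAB v hv.1 hvB).elim, hv.2.2]
  obtain ⟨j, hjJ, hja, hij⟩ : ∃ j ∈ J, 0 < a j ∧ G.Adj i j := by
    by_contra! hcon
    have hI : G.IsIndepSet ((insert i (J.filter fun j => 0 < a j) : Finset V) : Set V) := by
      intro u hu v hv huv
      simp only [Finset.coe_insert, Finset.coe_filter, Set.mem_insert_iff,
        Set.mem_ofPred_eq] at hu hv
      rcases hu with rfl | hu <;> rcases hv with rfl | hv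
      exacts [(huv rfl).elim, hcon v hv.1 hv.2, fun e => hcon u hu.1 hu.2 e.symm,
        hJ hu.1 hv.1 huv]
    have h1 := h _ hI
    rw [Finset.sum_insert (by simp [hiJ])] at h1
    have h2 : ∑ v ∈ J.filter (fun j => 0 < a j), a v = ∑ v ∈ J, a v := by
      refine Finset.sum_subset (Finset.filter_subset _ _) fun v hv hv' => ?_
      by_contra hne
      exact hv' (Finset.mem_filter.2 ⟨hv, Nat.pos_of_ne_zero hne⟩)
    omega
  refine ⟨{i, j}, Or.inr (Or.inr ⟨i, j, hij, rfl⟩), by simp [hi, hja], fun K hK hKb => ?_⟩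
  by_cases hiK : i ∈ K
  · exact ⟨i, by simp, hiK⟩
  · refine ⟨j, by simp, hJB K hK hKb hiK (Finset.mem_inter.2 ⟨hjJ, ?_⟩)⟩
    exact (hAB j).resolve_left fun hjA => same hiA hjA hij

lemma monomial_mem_RG [Fintype V] (hG : G.Colorable 2) {m : Option V →₀ ℕ} (hm : InCone G m) :
    (monomial m 1 : Amb K V) ∈ RG K G := by
  obtain ⟨c⟩ := hG
  induction hb : m none generalizing m with
  | zero =>
    have : m = 0 := by
      ext o
      cases o with
      | none => exact hb
      | some i => simpa [hb] using hm {i} (by simp [SimpleGraph.IsIndepSet])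
    subst this
    exact one_mem _
  | succ b ih =>
    obtain ⟨F, hF, hFm, hFI⟩ : ∃ F : Finset V, IsFace G F ∧ (∀ v ∈ F, 0 < m (some v)) ∧
        ∀ I : Finset V, G.IsIndepSet I → ∑ i ∈ I, m (some i) = b + 1 → ∃ v ∈ F, v ∈ I := by
      by_cases h0 : ∃ i, 0 < m (some i)
      · obtain ⟨i, hi⟩ := h0
        exact exists_face_meeting_tight c (fun i => m (some i)) (b + 1)
          (fun I hI => hb ▸ hm I hI) hi
      · push Not at h0
        refine ⟨∅, Or.inl rfl, by simp, fun I _ hI => ?_⟩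
        rw [Finset.sum_eq_zero fun i _ => Nat.le_zero.1 (h0 i)] at hI
        omega
    have hle : faceExp F ≤ m := by
      intro o
      cases o with
      | none => rw [faceExp_none]; omega
      | some i =>
        rw [faceExp_some]
        split_ifs with h
        exacts [hFm i h, Nat.zero_le _]
    obtain ⟨m', rfl⟩ := exists_add_of_le hle
    have hb' : m' none = b := by
      simp only [Finsupp.add_apply, faceExp_none] at hb
      omega
    rw [← mul_one (1 : K), ← monomial_mul, ← faceMon_eq_monomial]
    refine mul_mem (faceMon_mem_RG K hF) (ih ?_ hb')
    intro I hI
    have h1 := hm I hI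
    have h2 := hFI I hI
    simp only [Finsupp.add_apply, Finset.sum_add_distrib, sum_faceExp, faceExp_none] at h1 h2
    rw [hb'] at h1 ⊢
    by_contra hcon
    have hpos : 0 < (I ∩ F).card ∨ (I ∩ F).card = 0 := by omega
    rcases hpos with hpos | hpos
    · omega
    · obtain ⟨v, hvF, hvI⟩ := h2 (by omega)
      exact absurd (Finset.card_eq_zero.1 hpos)
        (Finset.ne_empty_of_mem (Finset.mem_inter.2 ⟨hvI, hvF⟩))

lemma mem_RG_of_inCone [Fintype V] (hG : G.Colorable 2) {f : Amb K V}
    (hf : ∀ m ∈ f.support, InCone G m) : f ∈ RG K G := by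
  rw [f.as_sum]
  refine sum_mem fun m hm => ?_
  rw [← mul_one (coeff m f), ← smul_eq_mul, ← smul_monomial]
  exact Subalgebra.smul_mem _ (monomial_mem_RG K hG (hf m hm)) _

variable (G) in
/-- The element `t` of `R_G`. -/
def tElt : RG K G := ⟨X none, X_none_mem_RG K G⟩

variable (G) in
/-- The element `x_i t` of `R_G`. -/
def vElt (i : V) : RG K G := ⟨vGen K i, vGen_mem_RG K G i⟩

variable {K}

lemma containsT_iff {P : Ideal (RG K G)} : ContainsT K G P ↔ tElt K G ∈ P :=
  ⟨fun ⟨u, hu, hut⟩ => (Subtype.ext hut : u = tElt K G) ▸ hu, fun h => ⟨_, h, rfl⟩⟩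

variable (G) in
lemma exists_mul_pow_mem_RG (f : Amb K V) : ∃ N, f * X none ^ N ∈ RG K G := by
  have ht := X_none_mem_RG K G
  induction f using MvPolynomial.induction_on with
  | C r => exact ⟨0, by simpa using (RG K G).algebraMap_mem r⟩
  | add f g hf hg =>
    obtain ⟨N, hN⟩ := hf
    obtain ⟨M, hM⟩ := hg
    refine ⟨N + M, ?_⟩
    have : (f + g) * X none ^ (N + M) =
        f * X none ^ N * X none ^ M + g * X none ^ M * X none ^ N := by ring
    rw [this]
    exact add_mem (mul_mem hN (pow_mem ht _)) (mul_mem hM (pow_mem ht _))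
  | mul_X f o hf =>
    obtain ⟨N, hN⟩ := hf
    cases o with
    | none =>
      refine ⟨N, ?_⟩
      rw [mul_right_comm]
      exact mul_mem hN ht
    | some i =>
      refine ⟨N + 1, ?_⟩
      have : f * X (some i) * X none ^ (N + 1) = f * X none ^ N * vGen K i := by
        unfold vGen; ring
      rw [this]
      exact mul_mem hN (vGen_mem_RG K G i)

lemma mem_of_X_dvd {P : Ideal (RG K G)} (hP : P.IsPrime) (ht : tElt K G ∉ P) {i : V}
    (hi : vElt K G i ∈ P) {u : RG K G} (hu : X (some i) ∣ (u : Amb K V)) : u ∈ P := by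
  obtain ⟨v, hv⟩ := hu
  obtain ⟨N, hN⟩ := exists_mul_pow_mem_RG G v
  have key : u * tElt K G ^ (N + 1) = vElt K G i * ⟨_, hN⟩ := by
    apply Subtype.ext
    simp only [MulMemClass.coe_mul, SubmonoidClass.coe_pow, hv, tElt, vElt, vGen]
    ring
  refine (hP.mem_or_mem (key ▸ P.mul_mem_right _ hi : u * tElt K G ^ (N + 1) ∈ P)).resolve_right ?_
  exact fun h => ht (hP.mem_of_pow_mem _ h)

lemma exists_vElt_mem [Fintype V] {P : Ideal (RG K G)} (hP : P.IsPrime) (hne : P ≠ ⊥)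
    (hmon : IsMonomialIdeal K G P) (ht : tElt K G ∉ P) : ∃ i, vElt K G i ∈ P := by
  obtain ⟨S, hS, rfl⟩ := hmon
  obtain ⟨u, hu⟩ : S.Nonempty := by
    rw [Set.nonempty_iff_ne_empty]
    rintro rfl
    simp at hne
  obtain ⟨a, b, hab⟩ := hS u hu
  have key : u * tElt K G ^ (∑ i, a i) = tElt K G ^ b * ∏ i, vElt K G i ^ a i := by
    apply Subtype.ext
    simp only [MulMemClass.coe_mul, SubmonoidClass.coe_pow, hab, tElt, vElt, vGen, monom,
      SubmonoidClass.coe_finsetProd, mul_pow, Finset.prod_mul_distrib, Finset.prod_pow_eq_pow_sum]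
    ring
  have hmem := Ideal.mul_mem_right (tElt K G ^ (∑ i, a i)) _ (Ideal.subset_span hu)
  rw [key] at hmem
  rcases hP.mem_or_mem hmem with h | h
  · exact (ht (hP.mem_of_pow_mem _ h)).elim
  · obtain ⟨i, -, hi⟩ := hP.prod_mem_iff.1 h
    exact ⟨i, hP.mem_of_pow_mem _ hi⟩

variable (K G) in
/-- The prime ideal of all elements of `R_G` divisible by `x_i` in the polynomial ring. -/
def vertexPrime (i : V) : Ideal (RG K G) :=
  (Ideal.span {(X (some i) : Amb K V)}).comap (RG K G).val

lemma mem_vertexPrime {i : V} {u : RG K G} :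
    u ∈ vertexPrime K G i ↔ X (some i) ∣ (u : Amb K V) := by
  rw [vertexPrime, Ideal.mem_comap, Ideal.mem_span_singleton]
  rfl

lemma tElt_notMem_vertexPrime (i : V) : tElt K G ∉ vertexPrime K G i := by
  rw [mem_vertexPrime, tElt, X_dvd_X]
  simp

lemma vElt_mem_vertexPrime (i : V) : vElt K G i ∈ vertexPrime K G i :=
  mem_vertexPrime.2 (dvd_mul_right _ _)

lemma heightOne_vertexPrime (i : V) : HeightOne K G (vertexPrime K G i) := by
  have hprime : (vertexPrime K G i).IsPrime := by
    have : (Ideal.span {(X (some i) : Amb K V)}).IsPrime :=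
      (Ideal.span_singleton_prime (X_ne_zero _)).2 X_prime
    exact Ideal.comap_isPrime _ _
  refine ⟨hprime, fun h => ?_, fun J hJ hlt => ?_⟩
  · have := vElt_mem_vertexPrime (K := K) (G := G) i
    rw [h, Ideal.mem_bot] at this
    have h0 : vGen K i = 0 := congrArg Subtype.val this
    exact mul_ne_zero (X_ne_zero _) (X_ne_zero _) h0
  · by_contra hne
    obtain ⟨f, hfJ, hf0⟩ := Submodule.exists_mem_ne_zero_of_ne_bot hne
    have htJ : tElt K G ∉ J := fun h => tElt_notMem_vertexPrime i (hlt.le h)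
    have hf0' : (f : Amb K V) ≠ 0 := fun h => hf0 (Subtype.ext h)
    have hX : Prime (X (some i) : Amb K V) := X_prime
    obtain ⟨g, hfg, hg⟩ :=
      (FiniteMultiplicity.of_prime_left hX hf0').exists_eq_pow_mul_and_not_dvd
    generalize multiplicity (X (some i) : Amb K V) (f : Amb K V) = k at hfg
    obtain ⟨N, hN⟩ := exists_mul_pow_mem_RG G g
    have key : f * tElt K G ^ (k + N) = vElt K G i ^ k * ⟨_, hN⟩ := by
      apply Subtype.ext
      simp only [MulMemClass.coe_mul, SubmonoidClass.coe_pow, hfg, tElt, vElt, vGen]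
      ring
    have hmem : vElt K G i ^ k * ⟨_, hN⟩ ∈ J := key ▸ J.mul_mem_right _ hfJ
    have hiJ : vElt K G i ∈ J := by
      rcases hJ.mem_or_mem hmem with h | h
      · exact hJ.mem_of_pow_mem _ h
      · rcases hX.dvd_or_dvd (mem_vertexPrime.1 (hlt.le h)) with h | h
        · exact (hg h).elim
        · exact (tElt_notMem_vertexPrime (K := K) (G := G) i
            (mem_vertexPrime.2 (hX.dvd_of_dvd_pow h))).elim
    exact hlt.not_ge fun u hu => mem_of_X_dvd hJ htJ hiJ (mem_vertexPrime.1 hu)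

lemma X_dvd_iff_forall_support {o : Option V} {f : Amb K V} :
    X o ∣ f ↔ ∀ m ∈ f.support, m o ≠ 0 := by
  rw [← Ideal.mem_span_singleton, ← Set.image_singleton, mem_ideal_span_X_image]
  simp

lemma isMonomialIdeal_vertexPrime [Fintype V] (hG : G.Colorable 2) (i : V) :
    IsMonomialIdeal K G (vertexPrime K G i) := by
  refine ⟨{u | IsMonomialElt K G u ∧ u ∈ vertexPrime K G i}, fun u hu => hu.1,
    le_antisymm (fun f hf => ?_) (Ideal.span_le.2 fun u hu => hu.2)⟩
  have hmon : ∀ m : (f : Amb K V).support, (monomial m.1 1 : Amb K V) ∈ RG K G :=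
    fun m => monomial_mem_RG K hG (inCone_of_mem_RG K f.2 m.2)
  have hfsum : f = ∑ m : (f : Amb K V).support,
      algebraMap K (RG K G) (coeff m.1 (f : Amb K V)) * ⟨_, hmon m⟩ := by
    apply Subtype.ext
    rw [AddSubmonoidClass.coe_finsetSum]
    simp only [MulMemClass.coe_mul, Subalgebra.coe_algebraMap, algebraMap_eq, C_mul_monomial,
      mul_one]
    rw [Finset.sum_coe_sort (f : Amb K V).support
      fun m => monomial m (coeff m (f : Amb K V))]
    exact (f : Amb K V).as_sum
  rw [hfsum]
  refine sum_mem fun m _ => Ideal.mul_mem_left _ _ (Ideal.subset_span ⟨?_, ?_⟩)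
  · exact ⟨_, _, monomial_eq_monom K m.1⟩
  · rw [mem_vertexPrime, X_dvd_monomial]
    exact Or.inr (X_dvd_iff_forall_support.1 (mem_vertexPrime.1 hf) _ m.2)

lemma sum_lt_of_mem_PC [Fintype V] {C : Finset V} (hC : IsVertexCover G C) {f : RG K G}
    (hf : f ∈ PC K G C) :
    ∀ m ∈ (f : Amb K V).support, ∑ i ∈ Cᶜ, m (some i) < m none := by
  have hI : G.IsIndepSet ((Cᶜ : Finset V) : Set V) := by
    intro i hi j hj _ hij
    simp only [Finset.coe_compl, Set.mem_compl_iff, Finset.mem_coe] at hi hj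
    exact (hC hij).elim hi hj
  induction hf using Submodule.span_induction with
  | mem u hu =>
    obtain ⟨F, -, hFC, hu⟩ := hu
    intro m hm
    rw [hu, faceMon_eq_monomial] at hm
    have : m = faceExp F := by simpa using support_monomial_subset hm
    have hd : Cᶜ ∩ F = ∅ := by
      ext v
      simpa using fun h1 h2 => h1 (hFC h2)
    rw [this, sum_faceExp, faceExp_none, hd]
    simp
  | zero => simp
  | add f g _ _ hf hg =>
    intro m hm
    rcases Finset.mem_union.1 (support_add hm) with h | h
    exacts [hf m h, hg m h]
  | smul r f _ hf =>
    refine forall_support_mul K (p := InCone G) (fun m hm => inCone_of_mem_RG K r.2 hm) hf ?_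
    intro m m' hm hm'
    have := hm _ hI
    simp only [Finsupp.add_apply, Finset.sum_add_distrib]
    omega

lemma exists_isMinVertexCover_subset_compl [Fintype V] {I : Finset V} (hI : G.IsIndepSet I) :
    ∃ C, IsMinVertexCover G C ∧ I ⊆ Cᶜ := by
  have hcov : IsVertexCover G Iᶜ := by
    intro i j hij
    by_contra! h
    simp only [Finset.mem_compl, not_not] at h
    exact hI (Finset.mem_coe.2 h.1) (Finset.mem_coe.2 h.2) hij.ne hij
  obtain ⟨C, hCI, hC⟩ := exists_minimal_le_of_wellFoundedLT (IsVertexCover G) Iᶜ hcov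
  exact ⟨C, ⟨hC.prop, fun C' hC' h => le_antisymm hC' (hC.le_of_le h hC')⟩,
    Finset.subset_compl_comm.1 hCI⟩

lemma tElt_mul_mem_canonicalIdeal [Fintype V] {u : RG K G}
    (hu : ∀ i, X (some i) ∣ (u : Amb K V)) : tElt K G * u ∈ canonicalIdeal K G := by
  rw [canonicalIdeal, Ideal.mem_sInf]
  rintro P ⟨⟨hP, hne, -⟩, hmon⟩
  by_cases ht : tElt K G ∈ P
  · exact P.mul_mem_right _ ht
  · obtain ⟨i, hi⟩ := exists_vElt_mem hP hne hmon ht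
    exact P.mul_mem_left _ (mem_of_X_dvd hP ht hi (hu i))

lemma exponent_of_mem_canonicalIdeal [Fintype V] (hG : G.Colorable 2)
    (hprimes : ∀ C, IsMinVertexCover G C →
      HeightOne K G (PC K G C) ∧ IsMonomialIdeal K G (PC K G C))
    {f : RG K G} (hf : f ∈ canonicalIdeal K G) {m : Option V →₀ ℕ}
    (hm : m ∈ (f : Amb K V).support) :
    (∀ i, m (some i) ≠ 0) ∧
      ∀ C, IsMinVertexCover G C → ∑ i ∈ Cᶜ, m (some i) < m none := by
  rw [canonicalIdeal, Ideal.mem_sInf] at hf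
  refine ⟨fun i => ?_, fun C hC => sum_lt_of_mem_PC hC.1 (hf (hprimes C hC)) m hm⟩
  exact X_dvd_iff_forall_support.1 (mem_vertexPrime.1
    (hf ⟨heightOne_vertexPrime i, isMonomialIdeal_vertexPrime hG i⟩)) m hm

lemma exists_mem_canonicalIdeal_of_faces [Fintype V] {g : V → Finset V}
    (hg : ∀ j, IsFace G (g j)) (hmem : ∀ j, j ∈ g j) :
    ∃ v ∈ canonicalIdeal K G,
      (v : Amb K V) = monomial (Finsupp.single none 1 + ∑ j, faceExp (g j)) 1 := by
  set u : RG K G := ⟨∏ j, faceMon K (g j), prod_mem fun j _ => faceMon_mem_RG K (hg j)⟩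
  refine ⟨tElt K G * u, tElt_mul_mem_canonicalIdeal fun i => ?_, ?_⟩
  · have h1 : (X (some i) : Amb K V) ∣ faceMon K (g i) :=
      (Finset.dvd_prod_of_mem (fun v => (X (some v) : Amb K V)) (hmem i)).trans
        (dvd_mul_right _ _)
    have h2 : faceMon K (g i) ∣ ∏ j, faceMon K (g j) :=
      Finset.dvd_prod_of_mem (fun j => faceMon K (g j)) (Finset.mem_univ i)
    exact h1.trans h2
  · rw [← mul_one (1 : K), ← monomial_mul, monomial_sum_one]
    simp only [← faceMon_eq_monomial]
    rfl

lemma exponent_of_mul_eq_monomial {w r : Amb K V} {d q : Option V →₀ ℕ}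
    (h : w * r = monomial q 1) (hd : d ∈ w.support) : ∃ p ∈ r.support, d + p = q := by
  classical
  have hdvd : w ∣ monomial q 1 * 1 := ⟨r, by rw [h, mul_one]⟩
  obtain ⟨m, s, hmq, hs, rfl⟩ := dvd_monomial_mul_iff_exists.1 hdvd
  obtain ⟨c, -, rfl⟩ := isUnit_iff_eq_C_of_isReduced.1 (isUnit_of_dvd_one hs)
  obtain ⟨p, rfl⟩ := exists_add_of_le hmq
  rw [mul_comm (monomial m 1), C_mul_monomial, mul_one] at h hd
  have hdm : d = m := by simpa using support_monomial_subset hd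
  refine ⟨p, ?_, by rw [hdm]⟩
  have := congrArg (coeff (m + p)) h
  rw [coeff_monomial_mul, coeff_monomial, if_pos rfl] at this
  rw [mem_support_iff]
  intro h0
  simp [h0] at this

lemma IsMinVertexCover.exists_face [Fintype V] {C : Finset V} (hC : IsMinVertexCover G C) (j : V) :
    ∃ F, IsFace G F ∧ j ∈ F ∧ (Cᶜ ∩ F).card = 1 := by
  by_cases hj : j ∈ C
  swap
  · refine ⟨{j}, Or.inr (Or.inl ⟨j, rfl⟩), by simp, ?_⟩
    rw [Finset.inter_singleton_of_mem (by simpa using hj), Finset.card_singleton]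
  have hnot : ¬ IsVertexCover G (C.erase j) := fun h =>
    Finset.notMem_erase j C ((hC.2 _ (Finset.erase_subset _ _) h).symm ▸ hj)
  obtain ⟨k, hjk, hk⟩ : ∃ k, G.Adj j k ∧ k ∉ C := by
    by_contra! hcon
    refine hnot fun a b hab => ?_
    by_cases ha : a = j
    · subst ha
      exact Or.inr (Finset.mem_erase.2 ⟨hab.ne', hcon b hab⟩)
    by_cases hb : b = j
    · subst hb
      exact Or.inl (Finset.mem_erase.2 ⟨hab.ne, hcon a hab.symm⟩)
    exact (hC.1 hab).imp (fun h => Finset.mem_erase.2 ⟨ha, h⟩)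
      fun h => Finset.mem_erase.2 ⟨hb, h⟩
  refine ⟨{j, k}, Or.inr (Or.inr ⟨j, k, hjk, rfl⟩), by simp, ?_⟩
  rw [Finset.inter_insert_of_notMem (by simpa using hj),
    Finset.inter_singleton_of_mem (by simpa using hk), Finset.card_singleton]

lemma exists_card_compl_eq_of_isPrincipal [Fintype V] (hG : G.Colorable 2)
    (hprimes : ∀ C, IsMinVertexCover G C →
      HeightOne K G (PC K G C) ∧ IsMonomialIdeal K G (PC K G C))
    (h : (canonicalIdeal K G).IsPrincipal) :
    ∃ s, ∀ C, IsMinVertexCover G C → Cᶜ.card + 1 = s := by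
  obtain ⟨w, hw⟩ := h
  have hwmem : w ∈ canonicalIdeal K G := hw ▸ Submodule.mem_span_singleton_self w
  have hgen : ∀ v ∈ canonicalIdeal K G, ∃ r : RG K G, (w : Amb K V) * r = v := by
    intro v hv
    rw [hw] at hv
    obtain ⟨r, rfl⟩ := Ideal.mem_span_singleton.1 hv
    exact ⟨r, rfl⟩
  have hface : ∀ j : V, IsFace G {j} := fun j => Or.inr (Or.inl ⟨j, rfl⟩)
  obtain ⟨v, hv, hvm⟩ := exists_mem_canonicalIdeal_of_faces (K := K) hface (by simp)
  obtain ⟨r, hr⟩ := hgen v hv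
  have hw0 : (w : Amb K V) ≠ 0 := by
    intro h0
    rw [hvm, h0, zero_mul] at hr
    exact one_ne_zero (monomial_eq_zero.1 hr.symm)
  obtain ⟨d, hd⟩ := support_nonempty.2 hw0
  obtain ⟨hd1, hdC⟩ := exponent_of_mem_canonicalIdeal hG hprimes hwmem hd
  have hd1' : ∀ i, d (some i) = 1 := by
    intro i
    obtain ⟨p, -, hp⟩ := exponent_of_mul_eq_monomial (hr.trans hvm) hd
    have := DFunLike.congr_fun hp (some i)
    simp only [Finsupp.add_apply, Finsupp.finsetSum_apply, faceExp_some] at this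
    simp at this
    have := hd1 i
    omega
  refine ⟨d none, fun C hC => ?_⟩
  choose g hg hmem hcard using hC.exists_face
  obtain ⟨v, hv, hvm⟩ := exists_mem_canonicalIdeal_of_faces (K := K) hg hmem
  obtain ⟨r, hr⟩ := hgen v hv
  obtain ⟨p, hp, hdp⟩ := exponent_of_mul_eq_monomial (hr.trans hvm) hd
  have hI : G.IsIndepSet ((Cᶜ : Finset V) : Set V) := by
    intro i hi j hj _ hij
    simp only [Finset.coe_compl, Set.mem_compl_iff, Finset.mem_coe] at hi hj
    exact (hC.1 hij).elim hi hj
  have hpC := inCone_of_mem_RG K r.2 hp Cᶜ hI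
  have hlt := hdC C hC
  have hnone := DFunLike.congr_fun hdp none
  have hsome : ∑ i ∈ Cᶜ, (d + p) (some i) = Fintype.card V := by
    rw [hdp]
    simp only [Finsupp.add_apply, Finsupp.finsetSum_apply]
    rw [Finset.sum_add_distrib, Finset.sum_comm]
    simp [sum_faceExp, hcard]
  simp only [Finsupp.add_apply, Finsupp.finsetSum_apply, faceExp_none] at hnone
  simp only [Finsupp.add_apply, Finset.sum_add_distrib] at hsome
  simp [hd1'] at hnone hsome hlt
  omega

lemma isPrincipal_of_card_compl_eq [Fintype V] (hG : G.Colorable 2)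
    (hprimes : ∀ C, IsMinVertexCover G C →
      HeightOne K G (PC K G C) ∧ IsMonomialIdeal K G (PC K G C))
    {s : ℕ} (hs : ∀ C, IsMinVertexCover G C → Cᶜ.card = s) :
    (canonicalIdeal K G).IsPrincipal := by
  set e : Option V →₀ ℕ := Finsupp.equivFunOnFinite.symm fun o => o.elim s fun _ => 1
  have he_some : ∀ i, e (some i) = 1 := fun _ => rfl
  have he_none : e none = s := rfl
  have he : InCone G e := by
    intro I hI
    obtain ⟨C, hC, hIC⟩ := exists_isMinVertexCover_subset_compl hI
    simpa [he_some, he_none, hs C hC] using Finset.card_le_card hIC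
  set u : RG K G := ⟨monomial e 1, monomial_mem_RG K hG he⟩
  have hw : ((tElt K G * u : RG K G) : Amb K V) = monomial (e + Finsupp.single none 1) 1 := by
    rw [add_comm, ← mul_one (1 : K), ← monomial_mul]
    rfl
  refine ⟨tElt K G * u, le_antisymm (fun f hf => ?_) ?_⟩
  · have hexp := fun {m} => exponent_of_mem_canonicalIdeal hG hprimes hf (m := m)
    have hdvd : (monomial (e + Finsupp.single none 1) 1 : Amb K V) ∣ f := by
      rw [← Ideal.mem_span_singleton]
      have := (mem_ideal_span_monomial_image (x := (f : Amb K V))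
        (s := {e + Finsupp.single none 1})).2 fun m hm => ⟨_, rfl, ?_⟩
      · simpa using this
      obtain ⟨h1, h2⟩ := hexp hm
      intro o
      cases o with
      | some i => simpa [he_some, Nat.one_le_iff_ne_zero] using h1 i
      | none =>
        obtain ⟨C, hC, -⟩ := exists_isMinVertexCover_subset_compl (G := G) (I := ∅) (by simp)
        have h3 : ∑ i ∈ Cᶜ, 1 ≤ ∑ i ∈ Cᶜ, m (some i) :=
          Finset.sum_le_sum fun i _ => Nat.one_le_iff_ne_zero.2 (h1 i)
        have h4 := h2 C hC
        simp only [Finset.sum_const, smul_eq_mul, mul_one, hs C hC] at h3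
        simp only [Finsupp.add_apply, he_none, Finsupp.single_eq_same]
        omega
    obtain ⟨g, hg⟩ := hdvd
    have hgR : g ∈ RG K G := by
      refine mem_RG_of_inCone K hG fun m hm I hI => ?_
      have hmem : e + Finsupp.single none 1 + m ∈ (f : Amb K V).support := by
        rw [mem_support_iff, hg, coeff_monomial_mul, one_mul]
        exact mem_support_iff.1 hm
      obtain ⟨C, hC, hIC⟩ := exists_isMinVertexCover_subset_compl hI
      have h2 := (hexp hmem).2 C hC
      have h3 := Finset.sum_le_sum_of_subset (f := fun i => m (some i)) hIC
      simp [Finset.sum_add_distrib, he_some, he_none, hs C hC] at h2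
      omega
    refine Ideal.mem_span_singleton.2 ⟨⟨g, hgR⟩, Subtype.ext ?_⟩
    rw [MulMemClass.coe_mul, hw]
    exact hg
  · refine (Ideal.span_singleton_le_iff_mem _).2 (tElt_mul_mem_canonicalIdeal fun i => ?_)
    exact X_dvd_monomial.2 (Or.inr (by simp [he_some]))

end

/-- Let `G` be a connected bipartite graph on `n` vertices, and
assume that the height one monomial prime ideals of `R_G` containing `t` are exactly
the ideals `P_C` for `C` a minimal vertex cover of `G`.  Then `R_G` is Gorenstein if
and only if `G` is unmixed. -/
theorem stmt10 (K : Type*) [Field K] {n : ℕ} (G : SimpleGraph (Fin n))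
    (hconn : G.Connected) (hbip : G.Colorable 2)
    (hprimes : {P : Ideal (RG K G) |
        HeightOne K G P ∧ IsMonomialIdeal K G P ∧ ContainsT K G P} =
      {P : Ideal (RG K G) | ∃ C : Finset (Fin n), IsMinVertexCover G C ∧ P = PC K G C}) :
    IsGorensteinToric K G ↔
      ∀ C₁ C₂ : Finset (Fin n), IsMinVertexCover G C₁ → IsMinVertexCover G C₂ →
        C₁.card = C₂.card := by
  have hprimes' : ∀ C, IsMinVertexCover G C →
      HeightOne K G (PC K G C) ∧ IsMonomialIdeal K G (PC K G C) := by
    intro C hC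
    have h := hprimes.ge ⟨C, hC, rfl⟩
    exact ⟨h.1, h.2.1⟩
  constructor
  · intro h C₁ C₂ h₁ h₂
    obtain ⟨s, hs⟩ := exists_card_compl_eq_of_isPrincipal hbip hprimes' h
    have e₁ := hs C₁ h₁
    have e₂ := hs C₂ h₂
    have f₁ := C₁.card_add_card_compl
    have f₂ := C₂.card_add_card_compl
    omega
  · intro h
    obtain ⟨C₀, h₀, -⟩ := exists_isMinVertexCover_subset_compl (G := G) (I := ∅) (by simp)
    refine isPrincipal_of_card_compl_eq hbip hprimes' (s := C₀ᶜ.card) fun C hC => ?_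
    rw [Finset.card_compl, Finset.card_compl, h C C₀ hC h₀]
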